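/- Let 𝓕 be a family of finite subsets of a set U satisfying axioms L1 and L2, and let G be the simple graph on vertex set 𝓕 in which two sets S, T ∈ 𝓕 are adjacent if and only if |S Δ T| = 1. Then G is a partial cube: for all S, T ∈ 𝓕, the graph distance between S and T in G equals |S Δ T|, the size of the symmetric difference of S and T. -/

import Mathlib

/-- Axiom L1 of a learning space. -/
def AxiomL1 {U : Type*} [DecidableEq U] (F : Set (Finset U)) : Prop :=
  ∀ S ∈ F, S.Nonempty → ∃ x ∈ S, S.erase x ∈ F

/-- Axiom L2 of a learning space. -/
def AxiomL2 {U : Type*} [DecidableEq U] (F : Set (Finset U)) : Prop :=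
  ∀ (S : Finset U) (x y : U), S ∈ F → insert x S ∈ F → insert y S ∈ F →
    insert x (insert y S) ∈ F

/-- A family satisfying axioms L1 and L2 is closed under unions. -/
theorem AxiomL2.union_mem {U : Type*} [DecidableEq U] {F : Set (Finset U)}
    (hL1 : AxiomL1 F) (hL2 : AxiomL2 F) {S T : Finset U} (hS : S ∈ F) (hT : T ∈ F) :
    S ∪ T ∈ F := by
  induction hn : S.card + T.card using Nat.strong_induction_on generalizing S T with
  | _ n ih =>
    rcases S.eq_empty_or_nonempty with rfl | hS'
    · simpa using hT
    rcases T.eq_empty_or_nonempty with rfl | hT'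
    · simpa using hS
    obtain ⟨x, hx, hxF⟩ := hL1 S hS hS'
    obtain ⟨y, hy, hyF⟩ := hL1 T hT hT'
    have hcx := Finset.card_erase_lt_of_mem hx
    have hcy := Finset.card_erase_lt_of_mem hy
    have h₀ := ih _ (by omega) hxF hyF rfl
    have h₁ := ih _ (by omega) hS hyF rfl
    have h₂ := ih _ (by omega) hxF hT rfl
    have e₁ : insert x (S.erase x ∪ T.erase y) = S ∪ T.erase y := by
      rw [← Finset.insert_union, Finset.insert_erase hx]
    have e₂ : insert y (S.erase x ∪ T.erase y) = S.erase x ∪ T := by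
      rw [← Finset.union_insert, Finset.insert_erase hy]
    have h := hL2 _ x y h₀ (e₁ ▸ h₁) (e₂ ▸ h₂)
    rwa [e₂, ← Finset.insert_union, Finset.insert_erase hx] at h

/-- If `T` is not contained in `S`, then `S` can be enlarged by an element of `T`. -/
theorem AxiomL2.exists_insert_mem {U : Type*} [DecidableEq U] {F : Set (Finset U)}
    (hL1 : AxiomL1 F) (hL2 : AxiomL2 F) {S T : Finset U} (hS : S ∈ F) (hT : T ∈ F)
    (hTS : ¬ T ⊆ S) : ∃ x ∈ T \ S, insert x S ∈ F := by
  induction hn : T.card using Nat.strong_induction_on generalizing T with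
  | _ n ih =>
    have hne : T.Nonempty := by
      rw [Finset.nonempty_iff_ne_empty]
      rintro rfl
      exact hTS (Finset.empty_subset S)
    obtain ⟨x, hx, hxF⟩ := hL1 T hT hne
    by_cases hsub : T.erase x ⊆ S
    · have hxS : x ∉ S := fun h => hTS (by
        rw [← Finset.insert_erase hx]
        exact Finset.insert_subset h hsub)
      refine ⟨x, Finset.mem_sdiff.2 ⟨hx, hxS⟩, ?_⟩
      have h := hL2.union_mem hL1 hT hS
      rwa [← Finset.insert_erase hx, Finset.insert_union, Finset.union_eq_right.2 hsub] at h
    · obtain ⟨y, hy, hyF⟩ := ih _ (hn ▸ Finset.card_erase_lt_of_mem hx) hxF hsub rfl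
      exact ⟨y, Finset.sdiff_subset_sdiff (Finset.erase_subset x T) subset_rfl hy, hyF⟩

/-- Inserting an element of `T \ S` into `S` lowers the size of the symmetric difference
with `T` by one. -/
theorem Finset.card_symmDiff_insert_add_one {U : Type*} [DecidableEq U] {S T : Finset U} {x : U}
    (hx : x ∈ T \ S) :
    ((insert x S \ T) ∪ (T \ insert x S)).card + 1 = ((S \ T) ∪ (T \ S)).card := by
  have e : (insert x S \ T) ∪ (T \ insert x S) = ((S \ T) ∪ (T \ S)).erase x := by
    ext y
    simp only [Finset.mem_union, Finset.mem_sdiff, Finset.mem_insert, Finset.mem_erase] at hx ⊢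
    grind
  rw [e, Finset.card_erase_add_one (Finset.mem_union_right _ hx)]

/-- Adjoining a new element to a set changes it by one element. -/
theorem Finset.card_symmDiff_insert_self {U : Type*} [DecidableEq U] {S : Finset U} {x : U}
    (hx : x ∉ S) : ((S \ insert x S) ∪ (insert x S \ S)).card = 1 := by
  rw [Finset.card_eq_one]
  exact ⟨x, by ext y; simp only [Finset.mem_union, Finset.mem_sdiff, Finset.mem_insert,
    Finset.mem_singleton]; grind⟩

/-- The size of the symmetric difference satisfies the triangle inequality. -/
theorem Finset.card_symmDiff_triangle {U : Type*} [DecidableEq U] (A B C : Finset U) :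
    ((A \ C) ∪ (C \ A)).card ≤ ((A \ B) ∪ (B \ A)).card + ((B \ C) ∪ (C \ B)).card :=
  (Finset.card_le_card (symmDiff_triangle A B C)).trans (Finset.card_union_le _ _)

/-- A learning space is a partial cube: in the graph on a family of finite sets
satisfying axioms L1 and L2 in which two sets are adjacent exactly when their
symmetric difference has one element, the graph distance between any two sets
equals the cardinality of their symmetric difference. -/
theorem partial_cube {U : Type*} [DecidableEq U] (F : Set (Finset U))
    (hL1 : AxiomL1 F) (hL2 : AxiomL2 F)
    (G : SimpleGraph {S // S ∈ F})
    (hG : ∀ A B : {S // S ∈ F},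
      G.Adj A B ↔ ((A.1 \ B.1) ∪ (B.1 \ A.1)).card = 1) :
    ∀ S T : {S // S ∈ F}, G.dist S T = ((S.1 \ T.1) ∪ (T.1 \ S.1)).card := by
  have lower : ∀ {S T : {S // S ∈ F}} (p : G.Walk S T),
      ((S.1 \ T.1) ∪ (T.1 \ S.1)).card ≤ p.length := by
    intro S T p
    induction p with
    | nil => simp
    | @cons A B C hAB q ih =>
      have hcard := (hG A B).1 hAB
      have htri := Finset.card_symmDiff_triangle A.1 B.1 C.1
      rw [SimpleGraph.Walk.length_cons]
      omega
  have upper : ∀ (n : ℕ) (S T : {S // S ∈ F}), ((S.1 \ T.1) ∪ (T.1 \ S.1)).card = n →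
      ∃ p : G.Walk S T, p.length = n := by
    intro n
    induction n with
    | zero =>
      intro S T h
      have hST : S = T := by
        rw [Finset.card_eq_zero, Finset.union_eq_empty, Finset.sdiff_eq_empty_iff_subset,
          Finset.sdiff_eq_empty_iff_subset] at h
        exact Subtype.ext (h.1.antisymm h.2)
      subst hST
      exact ⟨.nil, rfl⟩
    | succ n ih =>
      have step : ∀ S T : {S // S ∈ F}, ((S.1 \ T.1) ∪ (T.1 \ S.1)).card = n + 1 →
          ¬ T.1 ⊆ S.1 → ∃ p : G.Walk S T, p.length = n + 1 := by
        intro S T h hTS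
        obtain ⟨x, hx, hxF⟩ := hL2.exists_insert_mem hL1 S.2 T.2 hTS
        have hcard := Finset.card_symmDiff_insert_add_one hx
        obtain ⟨p, hp⟩ := ih ⟨insert x S.1, hxF⟩ T (by simp only; omega)
        have hadj : G.Adj S ⟨insert x S.1, hxF⟩ :=
          (hG _ _).2 (Finset.card_symmDiff_insert_self (Finset.mem_sdiff.1 hx).2)
        exact ⟨.cons hadj p, by rw [SimpleGraph.Walk.length_cons, hp]⟩
      intro S T h
      by_cases hTS : T.1 ⊆ S.1
      · have hST : ¬ S.1 ⊆ T.1 := fun hST => by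
          simp [Finset.sdiff_eq_empty_iff_subset.2 hST,
            Finset.sdiff_eq_empty_iff_subset.2 hTS] at h
        obtain ⟨p, hp⟩ := step T S (by rwa [Finset.union_comm]) hST
        exact ⟨p.reverse, by rw [SimpleGraph.Walk.length_reverse, hp]⟩
      · exact step S T h hTS
  intro S T
  obtain ⟨p, hp⟩ := upper _ S T rfl
  obtain ⟨q, hq⟩ := p.reachable.exists_walk_length_eq_dist
  exact le_antisymm (hp ▸ SimpleGraph.dist_le p) (hq ▸ lower q)
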